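/- The scaled Laplace–Runge–Lenz components are constants of motion on each energy region: for every i ∈ {1,2,3}, at every point (q,p) with qʲ ≠ 0 and pⱼ ≠ 0 for all j, if H_α(q,p) < 0 then {H_α, −Aᵅᵢ/√(−2mH_α)}_α = 0, and if H_α(q,p) > 0 then {H_α, −Aᵅᵢ/√(2mH_α)}_α = 0. -/

import Mathlib

noncomputable section

/-- The conformable power helper `|x|^(α-1) * x`. -/
def confPow (α x : ℝ) : ℝ := |x| ^ (α - 1) * x

/-- Partial derivative of `f : (q,p) ↦ ℝ` with respect to the coordinate `qⁱ`. -/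
def pdq (f : (Fin 3 → ℝ) → (Fin 3 → ℝ) → ℝ) (i : Fin 3) (q p : Fin 3 → ℝ) : ℝ :=
  deriv (fun t => f (Function.update q i t) p) (q i)

/-- Partial derivative of `f : (q,p) ↦ ℝ` with respect to the coordinate `pᵢ`. -/
def pdp (f : (Fin 3 → ℝ) → (Fin 3 → ℝ) → ℝ) (i : Fin 3) (q p : Fin 3 → ℝ) : ℝ :=
  deriv (fun t => f q (Function.update p i t)) (p i)

/-- The conformable Poisson bracket
`{f,g}_α = Σᵢ α⁻² |pᵢ|^{1-α} |qⁱ|^{1-α} (∂f/∂pᵢ ∂g/∂qⁱ - ∂f/∂qⁱ ∂g/∂pᵢ)`. -/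
def confPB (α : ℝ) (f g : (Fin 3 → ℝ) → (Fin 3 → ℝ) → ℝ) (q p : Fin 3 → ℝ) : ℝ :=
  ∑ i : Fin 3, (α ^ 2)⁻¹ * |p i| ^ (1 - α) * |q i| ^ (1 - α) *
    (pdp f i q p * pdq g i q p - pdq f i q p * pdp g i q p)

/-- The conformable radius `r_α = √(Σᵢ (α|qⁱ|^{α-1}qⁱ)²)`. -/
def rConf (α : ℝ) (q : Fin 3 → ℝ) : ℝ :=
  Real.sqrt (∑ i : Fin 3, (α * confPow α (q i)) ^ 2)

/-- The conformable Kepler Hamiltonian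
`H_α = Σᵢ (α|pᵢ|^{α-1}pᵢ)²/(2m) - k/r_α`. -/
def Hconf (α m k : ℝ) (q p : Fin 3 → ℝ) : ℝ :=
  (∑ i : Fin 3, (α * confPow α (p i)) ^ 2 / (2 * m)) - k / rConf α q

/-- The conformable angular momentum components (cyclic in the indices). -/
def Lconf (α : ℝ) (i : Fin 3) (q p : Fin 3 → ℝ) : ℝ :=
  α ^ 2 * (confPow α (q (i + 1)) * confPow α (p (i + 2)) -
           confPow α (q (i + 2)) * confPow α (p (i + 1)))

/-- The conformable Laplace–Runge–Lenz vector components (cyclic in the indices). -/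
def Aconf (α m k : ℝ) (i : Fin 3) (q p : Fin 3 → ℝ) : ℝ :=
  α * (confPow α (p (i + 1)) * Lconf α (i + 2) q p -
       confPow α (p (i + 2)) * Lconf α (i + 1) q p) -
  α * m * k / rConf α q * confPow α (q i)

/-- The scaled Laplace–Runge–Lenz vector on the negative-energy region:
`Γᵢ = -Aᵅᵢ/√(-2mH_α)`. -/
def GammaNeg (α m k : ℝ) (i : Fin 3) (q p : Fin 3 → ℝ) : ℝ :=
  -Aconf α m k i q p / Real.sqrt (-(2 * m * Hconf α m k q p))

/-- The scaled Laplace–Runge–Lenz vector on the positive-energy region: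
`Γ⁺ᵢ = -Aᵅᵢ/√(2mH_α)`. -/
def GammaPos (α m k : ℝ) (i : Fin 3) (q p : Fin 3 → ℝ) : ℝ :=
  -Aconf α m k i q p / Real.sqrt (2 * m * Hconf α m k q p)

/-- The Levi-Civita symbol `ε_{ijh} = (1/2)(i-j)(j-h)(h-i)`. -/
def levicivita (i j h : Fin 3) : ℝ :=
  ((i.1 : ℝ) - (j.1 : ℝ)) * ((j.1 : ℝ) - (h.1 : ℝ)) * ((h.1 : ℝ) - (i.1 : ℝ)) / 2

theorem hasDerivAt_confPow (α : ℝ) {x : ℝ} (hx : x ≠ 0) :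
    HasDerivAt (confPow α) (α * |x| ^ (α - 1)) x := by
  have h := (((hasDerivAt_abs hx).rpow_const (p := α - 1) (Or.inl (abs_ne_zero.2 hx))).mul
    (hasDerivAt_id x))
  refine h.congr_deriv ?_
  have hsign : (SignType.sign x : ℝ) * x = |x| := by
    rw [mul_comm]; exact self_mul_sign x
  have hpow : |x| ^ (α - 1 - 1) * |x| = |x| ^ (α - 1) := by
    rw [Real.rpow_sub_one (abs_ne_zero.2 hx) (α - 1), div_mul_cancel₀ _ (abs_ne_zero.2 hx)]
  simp only [id_eq, mul_one]
  linear_combination (α - 1) * |x| ^ (α - 1 - 1) * hsign + (α - 1) * hpow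

theorem hasDerivAt_confPow_update (α : ℝ) (q : Fin 3 → ℝ) {j : Fin 3} (hq : q j ≠ 0)
    (l : Fin 3) :
    HasDerivAt (fun t => confPow α (Function.update q j t l))
      (Pi.single (M := fun _ => ℝ) j (α * |q j| ^ (α - 1)) l) (q j) := by
  rcases eq_or_ne l j with rfl | h
  · simpa using hasDerivAt_confPow α hq
  · simpa [h] using hasDerivAt_const (q j) (confPow α (q l))

theorem rConf_sq (α : ℝ) (q : Fin 3 → ℝ) :
    rConf α q ^ 2 = ∑ l, (α * confPow α (q l)) ^ 2 :=
  Real.sq_sqrt (Finset.sum_nonneg fun _ _ => sq_nonneg _)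

theorem rConf_ne_zero {α : ℝ} (hα : α ≠ 0) {q : Fin 3 → ℝ} {j : Fin 3} (hq : q j ≠ 0) :
    rConf α q ≠ 0 := by
  refine (Real.sqrt_pos.2 ?_).ne'
  refine Finset.sum_pos' (fun _ _ => sq_nonneg _) ⟨j, Finset.mem_univ _, ?_⟩
  have : |q j| ^ (α - 1) ≠ 0 := (Real.rpow_pos_of_pos (abs_pos.2 hq) _).ne'
  unfold confPow
  positivity

section Curve

variable {α m k t : ℝ} {Q P : ℝ → Fin 3 → ℝ} {u v : Fin 3 → ℝ}

theorem hasDerivAt_rConf (hQ : ∀ l, HasDerivAt (fun s => confPow α (Q s l)) (u l) t)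
    (hr : rConf α (Q t) ≠ 0) :
    HasDerivAt (fun s => rConf α (Q s))
      (α ^ 2 * (∑ l, confPow α (Q t l) * u l) / rConf α (Q t)) t := by
  have hS : (∑ l, (α * confPow α (Q t l)) ^ 2) ≠ 0 := by
    rw [← rConf_sq]; exact pow_ne_zero 2 hr
  have h := (HasDerivAt.fun_sum (u := Finset.univ) fun l _ =>
    ((hQ l).const_mul α).pow 2).sqrt hS
  refine h.congr_deriv ?_
  change _ / (2 * rConf α (Q t)) = _
  simp only [Fin.sum_univ_three]
  field_simp
  push_cast
  ring

theorem hasDerivAt_Hconf (hm : m ≠ 0)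
    (hQ : ∀ l, HasDerivAt (fun s => confPow α (Q s l)) (u l) t)
    (hP : ∀ l, HasDerivAt (fun s => confPow α (P s l)) (v l) t) (hr : rConf α (Q t) ≠ 0) :
    HasDerivAt (fun s => Hconf α m k (Q s) (P s))
      (α ^ 2 * (∑ l, confPow α (P t l) * v l) / m +
        k * α ^ 2 * (∑ l, confPow α (Q t l) * u l) / rConf α (Q t) ^ 3) t := by
  have h := (HasDerivAt.fun_sum (u := Finset.univ) fun l _ =>
    (((hP l).const_mul α).pow 2).div_const (2 * m)).sub
      ((hasDerivAt_const t k).div (hasDerivAt_rConf hQ hr) hr)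
  refine h.congr_deriv ?_
  simp only [Fin.sum_univ_three]
  field_simp
  push_cast
  ring

theorem hasDerivAt_Lconf (hQ : ∀ l, HasDerivAt (fun s => confPow α (Q s l)) (u l) t)
    (hP : ∀ l, HasDerivAt (fun s => confPow α (P s l)) (v l) t) (i : Fin 3) :
    HasDerivAt (fun s => Lconf α i (Q s) (P s))
      (α ^ 2 * (u (i + 1) * confPow α (P t (i + 2)) + confPow α (Q t (i + 1)) * v (i + 2) -
        (u (i + 2) * confPow α (P t (i + 1)) + confPow α (Q t (i + 2)) * v (i + 1)))) t :=
  (((hQ _).mul (hP _)).sub ((hQ _).mul (hP _))).const_mul _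

theorem hasDerivAt_Aconf (hQ : ∀ l, HasDerivAt (fun s => confPow α (Q s l)) (u l) t)
    (hP : ∀ l, HasDerivAt (fun s => confPow α (P s l)) (v l) t) (hr : rConf α (Q t) ≠ 0)
    (i : Fin 3) :
    HasDerivAt (fun s => Aconf α m k i (Q s) (P s))
      (α ^ 3 * (v (i + 1) * (confPow α (Q t i) * confPow α (P t (i + 1)) -
            confPow α (Q t (i + 1)) * confPow α (P t i)) +
          confPow α (P t (i + 1)) *
            (u i * confPow α (P t (i + 1)) + confPow α (Q t i) * v (i + 1) -
              (u (i + 1) * confPow α (P t i) + confPow α (Q t (i + 1)) * v i)) -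
          v (i + 2) * (confPow α (Q t (i + 2)) * confPow α (P t i) -
            confPow α (Q t i) * confPow α (P t (i + 2))) -
          confPow α (P t (i + 2)) *
            (u (i + 2) * confPow α (P t i) + confPow α (Q t (i + 2)) * v i -
              (u i * confPow α (P t (i + 2)) + confPow α (Q t i) * v (i + 2)))) -
        α * m * k * (u i / rConf α (Q t) - confPow α (Q t i) *
          (α ^ 2 * (∑ l, confPow α (Q t l) * u l)) / rConf α (Q t) ^ 3)) t := by
  have h := ((((hP (i + 1)).mul (hasDerivAt_Lconf hQ hP (i + 2))).sub
    ((hP (i + 2)).mul (hasDerivAt_Lconf hQ hP (i + 1)))).const_mul α).sub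
      (((hasDerivAt_const t (α * m * k)).div (hasDerivAt_rConf hQ hr) hr).mul (hQ i))
  refine h.congr_deriv ?_
  have h₁ : i + 2 + 1 = i := by fin_cases i <;> rfl
  have h₂ : i + 2 + 2 = i + 1 := by fin_cases i <;> rfl
  have h₃ : i + 1 + 1 = i + 2 := by fin_cases i <;> rfl
  have h₄ : i + 1 + 2 = i := by fin_cases i <;> rfl
  simp only [Lconf, h₁, h₂, h₃, h₄, Pi.div_apply]
  field_simp
  ring

end Curve

section Bracket

variable {α m : ℝ} {q p : Fin 3 → ℝ}

theorem differentiableAt_update_Hconf (hα : α ≠ 0) (hm : m ≠ 0) (k : ℝ)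
    (hq : ∀ j, q j ≠ 0) (hp : ∀ j, p j ≠ 0) (j : Fin 3) :
    DifferentiableAt ℝ (fun t => Hconf α m k (Function.update q j t) p) (q j) ∧
    DifferentiableAt ℝ (fun t => Hconf α m k q (Function.update p j t)) (p j) :=
  ⟨(hasDerivAt_Hconf hm (hasDerivAt_confPow_update α q (hq j))
      (fun l => hasDerivAt_const _ (confPow α (p l)))
      (by simpa using rConf_ne_zero hα (hq j))).differentiableAt,
    (hasDerivAt_Hconf hm (fun l => hasDerivAt_const _ (confPow α (q l)))
      (hasDerivAt_confPow_update α p (hp j)) (rConf_ne_zero hα (hq j))).differentiableAt⟩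

theorem differentiableAt_update_Aconf (hα : α ≠ 0) (k : ℝ)
    (hq : ∀ j, q j ≠ 0) (hp : ∀ j, p j ≠ 0) (i j : Fin 3) :
    DifferentiableAt ℝ (fun t => Aconf α m k i (Function.update q j t) p) (q j) ∧
    DifferentiableAt ℝ (fun t => Aconf α m k i q (Function.update p j t)) (p j) :=
  ⟨(hasDerivAt_Aconf (hasDerivAt_confPow_update α q (hq j))
      (fun l => hasDerivAt_const _ (confPow α (p l)))
      (by simpa using rConf_ne_zero hα (hq j)) i).differentiableAt,
    (hasDerivAt_Aconf (fun l => hasDerivAt_const _ (confPow α (q l)))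
      (hasDerivAt_confPow_update α p (hp j)) (rConf_ne_zero hα (hq j)) i).differentiableAt⟩

theorem confPB_Hconf_Aconf (hα : α ≠ 0) (hm : m ≠ 0) (k : ℝ)
    (hq : ∀ j, q j ≠ 0) (hp : ∀ j, p j ≠ 0) (i : Fin 3) :
    confPB α (Hconf α m k) (Aconf α m k i) q p = 0 := by
  have hr : rConf α q ≠ 0 := rConf_ne_zero hα (hq 0)
  have Hq := fun j => (hasDerivAt_Hconf (k := k) hm (hasDerivAt_confPow_update α q (hq j))
      (fun l => hasDerivAt_const _ (confPow α (p l))) (by simpa using hr)).deriv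
  have Hp := fun j => (hasDerivAt_Hconf (k := k) hm (fun l => hasDerivAt_const _ (confPow α (q l)))
      (hasDerivAt_confPow_update α p (hp j)) hr).deriv
  have Aq := fun j => (hasDerivAt_Aconf (m := m) (k := k) (hasDerivAt_confPow_update α q (hq j))
      (fun l => hasDerivAt_const _ (confPow α (p l))) (by simpa using hr) i).deriv
  have Ap := fun j => (hasDerivAt_Aconf (m := m) (k := k)
      (fun l => hasDerivAt_const _ (confPow α (q l)))
      (hasDerivAt_confPow_update α p (hp j)) hr i).deriv
  simp only [Function.update_eq_self] at Hq Hp Aq Ap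
  have inv (x : ℝ) : |x| ^ (1 - α) = (|x| ^ (α - 1))⁻¹ := by
    rw [← Real.rpow_neg (abs_nonneg x), neg_sub]
  have ha (j) : |q j| ^ (α - 1) ≠ 0 := (Real.rpow_pos_of_pos (abs_pos.2 (hq j)) _).ne'
  have hb (j) : |p j| ^ (α - 1) ≠ 0 := (Real.rpow_pos_of_pos (abs_pos.2 (hp j)) _).ne'
  have hsq := rConf_sq α q
  simp only [confPB, pdq, pdp, Hq, Hp, Aq, Ap, inv]
  generalize rConf α q = r at *
  have ha0 := ha 0
  have ha1 := ha 1
  have ha2 := ha 2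
  have hb0 := hb 0
  have hb1 := hb 1
  have hb2 := hb 2
  clear Hq Hp Aq Ap
  simp only [Fin.sum_univ_three] at hsq ⊢
  generalize |q 0| ^ (α - 1) = a0, |q 1| ^ (α - 1) = a1, |q 2| ^ (α - 1) = a2,
    |p 0| ^ (α - 1) = b0, |p 1| ^ (α - 1) = b1, |p 2| ^ (α - 1) = b2 at *
  fin_cases i <;> simp <;> field_simp
  · linear_combination -α ^ 3 * m * k * confPow α (p 0) * hsq
  · linear_combination -α ^ 3 * m * k * confPow α (p 1) * hsq
  · linear_combination -α ^ 3 * m * k * confPow α (p 2) * hsq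

/-- The bracket with `H` annihilates every function of `H` and of a constant of motion. -/
theorem confPB_comp_eq_zero {f g : (Fin 3 → ℝ) → (Fin 3 → ℝ) → ℝ} {φ : ℝ × ℝ → ℝ}
    (hφ : DifferentiableAt ℝ φ (f q p, g q p))
    (hf : ∀ j, DifferentiableAt ℝ (fun t => f (Function.update q j t) p) (q j) ∧
      DifferentiableAt ℝ (fun t => f q (Function.update p j t)) (p j))
    (hg : ∀ j, DifferentiableAt ℝ (fun t => g (Function.update q j t) p) (q j) ∧
      DifferentiableAt ℝ (fun t => g q (Function.update p j t)) (p j))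
    (hfg : confPB α f g q p = 0) :
    confPB α f (fun q p => φ (f q p, g q p)) q p = 0 := by
  set D := fderiv ℝ φ (f q p, g q p)
  have hD (x y : ℝ) : D (x, y) = x * D (1, 0) + y * D (0, 1) := by
    rw [← smul_eq_mul, ← smul_eq_mul, ← map_smul, ← map_smul, ← map_add]
    simp
  have hqj (j) : pdq (fun q p => φ (f q p, g q p)) j q p =
      pdq f j q p * D (1, 0) + pdq g j q p * D (0, 1) := by
    rw [← hD]
    refine (HasFDerivAt.comp_hasDerivAt_of_eq (q j) hφ.hasFDerivAt
      ((hf j).1.hasDerivAt.prodMk (hg j).1.hasDerivAt) ?_).deriv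
    simp
  have hpj (j) : pdp (fun q p => φ (f q p, g q p)) j q p =
      pdp f j q p * D (1, 0) + pdp g j q p * D (0, 1) := by
    rw [← hD]
    refine (HasFDerivAt.comp_hasDerivAt_of_eq (p j) hφ.hasFDerivAt
      ((hf j).2.hasDerivAt.prodMk (hg j).2.hasDerivAt) ?_).deriv
    simp
  calc
    _ = confPB α f g q p * D (0, 1) := by
      simp only [confPB, hqj, hpj, Finset.sum_mul]
      exact Finset.sum_congr rfl fun _ _ => by ring
    _ = 0 := by rw [hfg, zero_mul]

end Bracket

/-- the scaled Laplace–Runge–Lenz components are constants of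
motion on each energy region. -/
theorem confPB_Hconf_Gamma_eq_zero
    (α m k : ℝ) (hα : 1 ≤ α) (hm : 0 < m)
    (q p : Fin 3 → ℝ) (hq : ∀ j, q j ≠ 0) (hp : ∀ j, p j ≠ 0)
    (i : Fin 3) :
    (Hconf α m k q p < 0 →
      confPB α (Hconf α m k) (GammaNeg α m k i) q p = 0) ∧
    (0 < Hconf α m k q p →
      confPB α (Hconf α m k) (GammaPos α m k i) q p = 0) := by
  have hα' : α ≠ 0 := by positivity
  have hH := differentiableAt_update_Hconf hα' hm.ne' k hq hp
  have hA := differentiableAt_update_Aconf (m := m) hα' k hq hp i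
  have hHA := confPB_Hconf_Aconf hα' hm.ne' k hq hp i
  constructor <;> intro hE
  · have hpos : 0 < -(2 * m * Hconf α m k q p) :=
      neg_pos.2 (mul_neg_of_pos_of_neg (by positivity) hE)
    refine confPB_comp_eq_zero (φ := fun x => -x.2 / √(-(2 * m * x.1))) ?_ hH hA hHA
    fun_prop (disch := first | exact hpos.ne' | exact (Real.sqrt_pos.2 hpos).ne')
  · have hpos : 0 < 2 * m * Hconf α m k q p := by positivity
    refine confPB_comp_eq_zero (φ := fun x => -x.2 / √(2 * m * x.1)) ?_ hH hA hHA
    fun_prop (disch := first | exact hpos.ne' | exact (Real.sqrt_pos.2 hpos).ne')
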